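/- Let (P,≤,') be a downward directed poset with an antitone involution, ⊓ an assigned meet-directoid operation on P (i.e. ⊓ is commutative, x⊓y ∈ L(x,y) for all x,y, and x ≤ y if and only if x⊓y = x), and define x⊔y := (x'⊓y')'. Then P is distributive if and only if the following implication (12) holds: whenever w,s,x,y,z ∈ P satisfy w⊓((t⊔x)⊔(t⊔y)) = w and w⊓z = w and s⊔((t⊓x)⊓(t⊓z)) = s and s⊔((t⊓y)⊓(t⊓z)) = s for all t ∈ P, then w ≤ s. -/

import Mathlib

/-- `m` is a meet-directoid operation assigned to the poset `P`:
it is commutative, `x ⊓ y` is a lower bound of `x` and `y`, and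
`x ≤ y` if and only if `x ⊓ y = x`. -/
def AssignedDirectoid {P : Type*} [PartialOrder P] (m : P → P → P) : Prop :=
  (∀ x y : P, m x y = m y x) ∧
  (∀ x y : P, m x y ∈ lowerBounds {x, y}) ∧
  (∀ x y : P, x ≤ y ↔ m x y = x)

/-- A poset is distributive if `L(U(x,y),z) = L(U(L(x,z) ∪ L(y,z)))` for all `x,y,z`. -/
def DistributivePoset (P : Type*) [PartialOrder P] : Prop :=
  ∀ x y z : P,
    lowerBounds (upperBounds {x, y} ∪ {z}) =
      lowerBounds (upperBounds (lowerBounds {x, z} ∪ lowerBounds {y, z}))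

/-- In an assigned directoid, the elements `(t ⊓ x) ⊓ (t ⊓ y)` are exactly the common lower
bounds of `x` and `y`. -/
theorem AssignedDirectoid.range_eq_lowerBounds {P : Type*} [PartialOrder P] {m : P → P → P}
    (hm : AssignedDirectoid m) (x y : P) :
    Set.range (fun t => m (m t x) (m t y)) = lowerBounds {x, y} := by
  obtain ⟨-, hlb, hle⟩ := hm
  have left (a b : P) : m a b ≤ a := hlb a b (by simp)
  have right (a b : P) : m a b ≤ b := hlb a b (by simp)
  ext v
  constructor
  · rintro ⟨t, rfl⟩
    simpa [lowerBounds_insert] using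
      ⟨(left _ _).trans (right t x), (right (m t x) _).trans (right t y)⟩
  · intro hv
    have hx : m v x = v := (hle v x).1 (hv (by simp))
    have hy : m v y = v := (hle v y).1 (hv (by simp))
    exact ⟨v, by simp only [hx, hy, (hle v v).1 le_rfl]⟩

/-- The dual of a meet-directoid under an antitone involution is assigned to the dual poset. -/
theorem AssignedDirectoid.dual {P : Type*} [PartialOrder P] {f : P → P}
    (hinv : ∀ x, f (f x) = x) (hant : ∀ x y : P, x ≤ y → f y ≤ f x)
    {m : P → P → P} (hm : AssignedDirectoid m)
    {j : P → P → P} (hj : ∀ x y : P, j x y = f (m (f x) (f y))) :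
    AssignedDirectoid (P := Pᵒᵈ)
      (fun x y => OrderDual.toDual (j (OrderDual.ofDual x) (OrderDual.ofDual y))) := by
  obtain ⟨hcomm, hlb, hle⟩ := hm
  have hiff (x y : P) : f x ≤ f y ↔ y ≤ x :=
    ⟨fun h => by simpa only [hinv] using hant _ _ h, hant y x⟩
  have left (x y : P) : x ≤ j x y := by
    rw [hj, ← hiff, hinv]
    exact hlb _ _ (by simp)
  have comm (x y : P) : j x y = j y x := by rw [hj, hj, hcomm]
  have le_iff (x y : P) : y ≤ x ↔ j x y = x := by
    rw [← hiff, hle, hj]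
    exact ⟨fun h => by rw [h, hinv], fun h => by rw [← hinv (m _ _), h]⟩
  refine ⟨comm, fun x y => ?_, le_iff⟩
  rintro a (rfl | rfl)
  · exact left a y
  · exact (left a x).trans_eq (comm a x)

/-- A poset is distributive as soon as `L(U(x,y),z)` lies below `U(L(x,z) ∪ L(y,z))`. -/
theorem distributivePoset_iff {P : Type*} [PartialOrder P] :
    DistributivePoset P ↔ ∀ w s x y z : P, w ∈ lowerBounds (upperBounds {x, y}) → w ≤ z →
      s ∈ upperBounds (lowerBounds {x, z}) → s ∈ upperBounds (lowerBounds {y, z}) → w ≤ s := by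
  constructor
  · intro h w s x y z hw hwz hsx hsy
    have hmem : w ∈ lowerBounds (upperBounds {x, y} ∪ {z}) := by
      rw [lowerBounds_union, lowerBounds_singleton]
      exact ⟨hw, hwz⟩
    rw [h] at hmem
    exact hmem (by rw [upperBounds_union]; exact ⟨hsx, hsy⟩)
  · intro h x y z
    apply Set.Subset.antisymm
    · intro w hw s hs
      rw [lowerBounds_union, lowerBounds_singleton] at hw
      rw [upperBounds_union] at hs
      exact h w s x y z hw.1 hw.2 hs.1 hs.2
    · rintro w hw u (hu | rfl)
      · refine hw ?_
        rintro v (hv | hv)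
        · exact (hv (by simp)).trans (hu (by simp : x ∈ ({x, y} : Set P)))
        · exact (hv (by simp)).trans (hu (by simp : y ∈ ({x, y} : Set P)))
      · refine hw ?_
        rintro v (hv | hv) <;> exact hv (by simp)

theorem stmt_8 {P : Type*} [PartialOrder P]
    (hdir : ∀ x y : P, (lowerBounds {x, y}).Nonempty)
    (f : P → P) (hinv : ∀ x, f (f x) = x) (hant : ∀ x y : P, x ≤ y → f y ≤ f x)
    (m : P → P → P) (hm : AssignedDirectoid m)
    (j : P → P → P) (hj : ∀ x y : P, j x y = f (m (f x) (f y))) :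
    DistributivePoset P ↔
      (∀ w s x y z : P,
        (∀ t : P, m w (j (j t x) (j t y)) = w) →
        m w z = w →
        (∀ t : P, j s (m (m t x) (m t z)) = s) →
        (∀ t : P, j s (m (m t y) (m t z)) = s) →
        w ≤ s) := by
  have hd := hm.dual hinv hant hj
  have hjle (s a : P) : j s a = s ↔ a ≤ s := (hd.2.2 s a).symm
  have hupper (x y : P) : Set.range (fun t => j (j t x) (j t y)) = upperBounds {x, y} :=
    hd.range_eq_lowerBounds x y
  simp only [distributivePoset_iff, ← hupper, ← hm.range_eq_lowerBounds, mem_lowerBounds,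
    mem_upperBounds, Set.forall_mem_range, hjle, ← hm.2.2]
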